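/- Let Γ = ⟨x, y ∣ x² = y³⟩ be the trefoil knot group. For every irreducible representation ρ: Γ → SL₃(ℂ), one has ρ(x)² = ρ(y)³ = Id₃. -/

import Mathlib

/-- The single relator `x² y⁻³` of the trefoil knot group. -/
def trefoilRels : Set (FreeGroup Bool) := {FreeGroup.of true ^ 2 * (FreeGroup.of false ^ 3)⁻¹}

/-- The trefoil knot group `⟨x, y ∣ x² = y³⟩`. -/
abbrev TrefoilGroup := PresentedGroup trefoilRels

/-- The generator `x`. -/
def trefX : TrefoilGroup := PresentedGroup.of true

/-- The generator `y`. -/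
def trefY : TrefoilGroup := PresentedGroup.of false

open Polynomial in
/-- If `q ≠ 0` annihilates `f` and all eigenspaces of `f` have dimension at most `k`, then the
whole space has dimension at most `k * deg q`. -/
theorem finrank_le_natDegree_mul_of_aeval_eq_zero {K V : Type*} [Field K] [IsAlgClosed K]
    [AddCommGroup V] [Module K V] [FiniteDimensional K V] (f : Module.End K V) (k : ℕ)
    (hk : ∀ a, Module.finrank K (f.eigenspace a) ≤ k) {q : K[X]} (hq : q ≠ 0)
    (hf : aeval f q = 0) : Module.finrank K V ≤ q.natDegree * k := by
  have key (s : Multiset K) :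
      Module.finrank K (LinearMap.ker (aeval f (s.map fun a => X - C a).prod)) ≤ s.card * k := by
    induction s using Multiset.induction_on with
    | empty =>
      rw [Multiset.map_zero, Multiset.prod_zero, map_one, Module.End.one_eq_id, LinearMap.ker_id]
      simp
    | cons a s ih =>
      set g := aeval f (s.map fun a => X - C a).prod
      set h := f - algebraMap K (Module.End K V) a with hh
      have e : aeval f ((a ::ₘ s).map fun a => X - C a).prod = h * g := by
        simp [g, hh]
      have ha : Module.finrank K (LinearMap.ker h) ≤ k := by
        rw [hh, Algebra.algebraMap_eq_smul_one, ← Module.End.eigenspace_def]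
        exact hk a
      let r : LinearMap.ker (h * g) →ₗ[K] LinearMap.ker h :=
        g.restrict fun v hv => by simpa using hv
      have hr := r.finrank_range_add_finrank_ker
      have h1 := (LinearMap.range r).finrank_le
      have h2 : Module.finrank K (LinearMap.ker r) ≤ Module.finrank K (LinearMap.ker g) := by
        let i : LinearMap.ker r →ₗ[K] LinearMap.ker g :=
          ((LinearMap.ker (h * g)).subtype ∘ₗ (LinearMap.ker r).subtype).codRestrict _ fun v =>
            congrArg Subtype.val (LinearMap.mem_ker.mp v.2)
        refine LinearMap.finrank_le_finrank_of_injective (f := i) fun u v huv => ?_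
        have huv := congrArg Subtype.val huv
        exact Subtype.ext (Subtype.ext huv)
      rw [e, Multiset.card_cons, add_mul, one_mul]
      omega
  have hs := (IsAlgClosed.splits q).eq_prod_roots
  have h0 : aeval f (q.roots.map fun a => X - C a).prod = 0 := by
    rw [hs, map_mul, aeval_C, ← Algebra.smul_def] at hf
    exact (smul_eq_zero.mp hf).resolve_left (leadingCoeff_ne_zero.mpr hq)
  have := key q.roots
  rw [h0, LinearMap.ker_zero, finrank_top] at this
  exact this.trans (Nat.mul_le_mul_right k q.card_roots')

open Polynomial in
/-- A polynomial of degree at most `2` annihilating an endomorphism of a space of dimension greater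
than `2` forces an eigenspace of dimension at least `2`. -/
theorem exists_two_le_finrank_eigenspace {K V : Type*} [Field K] [IsAlgClosed K]
    [AddCommGroup V] [Module K V] [FiniteDimensional K V] (f : Module.End K V)
    (hV : 2 < Module.finrank K V) {q : K[X]} (hq : q ≠ 0) (hdeg : q.natDegree ≤ 2)
    (hf : aeval f q = 0) : ∃ a, 2 ≤ Module.finrank K (f.eigenspace a) := by
  by_contra! h
  have := finrank_le_natDegree_mul_of_aeval_eq_zero f 1 (fun a => Nat.le_of_lt_succ (h a)) hq hf
  omega

open Polynomial in
/-- If `A` is a `3 × 3` matrix with `A ^ 3 = ω`, `ω ≠ det A`, then `A` is annihilated by a nonzero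
polynomial of degree at most `2`. -/
theorem exists_aeval_eq_zero_of_pow_three_eq {K : Type*} [Field K]
    (A : Matrix (Fin 3) (Fin 3) K) {ω : K} (hA : A ^ 3 = algebraMap K _ ω) (hω : ω ≠ A.det) :
    ∃ q : K[X], q ≠ 0 ∧ q.natDegree ≤ 2 ∧ aeval A q = 0 := by
  refine ⟨X ^ 3 - C ω - A.charpoly, fun h => hω ?_, ?_, ?_⟩
  · have h0 := congrArg (coeff · 0) h
    have hd := A.det_eq_sign_charpoly_coeff
    simp at h0 hd
    linear_combination -hd - h0
  · have h3 : A.charpoly.natDegree = 3 := by simp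
    have hl : A.charpoly.coeff 3 = 1 := by
      simpa [h3] using (A.charpoly_monic).coeff_natDegree
    rw [natDegree_le_iff_coeff_eq_zero]
    intro N hN
    obtain rfl | hN := (show 3 ≤ N from hN).eq_or_lt
    · simp [hl]
    · rw [coeff_sub, coeff_sub, coeff_X_pow, coeff_C,
        coeff_eq_zero_of_natDegree_lt (p := A.charpoly) (by omega)]
      simp [show N ≠ 3 by omega, show N ≠ 0 by omega]
  · simp [hA, Matrix.aeval_self_charpoly]

theorem trefX_sq_eq_trefY_cube : trefX ^ 2 = trefY ^ 3 := by
  have h := PresentedGroup.one_of_mem (rels := trefoilRels)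
    (x := FreeGroup.of true ^ 2 * (FreeGroup.of false ^ 3)⁻¹) rfl
  rw [map_mul, map_inv, mul_inv_eq_one, map_pow, map_pow] at h
  exact h

theorem TrefoilGroup.eq_top_of_mem {H : Subgroup TrefoilGroup} (hx : trefX ∈ H)
    (hy : trefY ∈ H) : H = ⊤ := by
  rw [eq_top_iff, ← PresentedGroup.closure_range_of, Subgroup.closure_le]
  rintro _ ⟨_ | _, rfl⟩
  exacts [hy, hx]

theorem commute_trefX_sq (γ : TrefoilGroup) : Commute γ (trefX ^ 2) := by
  have h : Subgroup.centralizer {trefX ^ 2} = ⊤ := by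
    refine TrefoilGroup.eq_top_of_mem ?_ ?_ <;> rw [Subgroup.mem_centralizer_singleton_iff]
    · exact (Commute.refl trefX).pow_right 2
    · rw [trefX_sq_eq_trefY_cube]
      exact (Commute.refl trefY).pow_right 3
  exact Subgroup.mem_centralizer_singleton_iff.mp (h ▸ Subgroup.mem_top γ)

/-- The subgroup of those `g` for which `v` is an eigenvector of `ρ g`. -/
def eigenvectorStabilizer {G K n : Type*} [Group G] [Field K] [Fintype n] [DecidableEq n]
    (ρ : G →* Matrix.SpecialLinearGroup n K) (v : n → K) (hv : v ≠ 0) : Subgroup G where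
  carrier := {g | ∃ c : K, (ρ g : Matrix n n K).mulVec v = c • v}
  one_mem' := ⟨1, by simp⟩
  mul_mem' := by
    rintro g h ⟨c, hc⟩ ⟨d, hd⟩
    refine ⟨d * c, ?_⟩
    rw [map_mul, Matrix.SpecialLinearGroup.coe_mul, ← Matrix.mulVec_mulVec, hd,
      Matrix.mulVec_smul, hc, smul_smul]
  inv_mem' := by
    rintro g ⟨c, hc⟩
    have h : v = c • (ρ g⁻¹ : Matrix n n K).mulVec v := by
      rw [← Matrix.mulVec_smul, ← hc, Matrix.mulVec_mulVec,
        ← Matrix.SpecialLinearGroup.coe_mul, ← map_mul]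
      simp
    have hc0 : c ≠ 0 := by
      rintro rfl
      exact hv (by simpa using h)
    exact ⟨c⁻¹, by rw [eq_inv_smul_iff₀ hc0, ← h]⟩

/-- **Lemma 9.6.** For every irreducible representation `ρ : Γ → SL₃(ℂ)` of the trefoil knot
group `Γ = ⟨x, y ∣ x² = y³⟩`, one has `ρ(x)² = ρ(y)³ = Id₃`. -/
theorem trefoil_irreducible_SL3_central_element_eq_one
    (ρ : TrefoilGroup →* Matrix.SpecialLinearGroup (Fin 3) ℂ)
    (hirr : ∀ W : Submodule ℂ (Fin 3 → ℂ),
      (∀ γ : TrefoilGroup, ∀ v ∈ W, (ρ γ : Matrix (Fin 3) (Fin 3) ℂ).mulVec v ∈ W) →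
      W = ⊥ ∨ W = ⊤) :
    ρ trefX ^ 2 = 1 ∧ ρ trefY ^ 3 = 1 := by
  set M : TrefoilGroup → Matrix (Fin 3) (Fin 3) ℂ := fun γ => (ρ γ : Matrix (Fin 3) (Fin 3) ℂ)
    with hM
  have hmul (a b : TrefoilGroup) : M (a * b) = M a * M b := by simp [hM]
  obtain ⟨ω, hω⟩ := Module.End.exists_eigenvalue (Matrix.toLin' (M (trefX ^ 2)))
  have htop : Module.End.eigenspace (Matrix.toLin' (M (trefX ^ 2))) ω = ⊤ := by
    refine (hirr _ fun γ v hv => ?_).resolve_left hω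
    rw [Module.End.mem_eigenspace_iff, Matrix.toLin'_apply] at hv ⊢
    change (M _).mulVec ((M γ).mulVec v) = ω • (M γ).mulVec v
    rw [Matrix.mulVec_mulVec, ← hmul, ← (commute_trefX_sq γ).eq, hmul, ← Matrix.mulVec_mulVec, hv,
      Matrix.mulVec_smul]
  have hscalar : M (trefX ^ 2) = algebraMap ℂ _ ω := by
    refine Matrix.toLin'.injective (LinearMap.ext fun v => ?_)
    have hv : v ∈ Module.End.eigenspace (Matrix.toLin' (M (trefX ^ 2))) ω :=
      htop ▸ Submodule.mem_top
    rw [Module.End.mem_eigenspace_iff.mp hv, Algebra.algebraMap_eq_smul_one]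
    simp
  have hX : M trefX ^ 2 = algebraMap ℂ _ ω := by simpa [hM] using hscalar
  have hY : M trefY ^ 3 = algebraMap ℂ _ ω := by
    simpa [hM, trefX_sq_eq_trefY_cube] using hscalar
  suffices h1 : ω = 1 by
    subst h1
    exact ⟨Subtype.ext (by simpa [hM] using hX), Subtype.ext (by simpa [hM] using hY)⟩
  by_contra hne
  have hdim : Module.finrank ℂ (Fin 3 → ℂ) = 3 := by simp
  have aeval_toLin' (A : Matrix (Fin 3) (Fin 3) ℂ) (q : Polynomial ℂ)
      (hq : Polynomial.aeval A q = 0) : Polynomial.aeval (Matrix.toLin' A) q = 0 := by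
    have := Polynomial.aeval_algHom_apply (Matrix.toLinAlgEquiv' (R := ℂ) (n := Fin 3)) A q
    rw [hq, map_zero] at this
    exact this
  obtain ⟨a, ha⟩ := exists_two_le_finrank_eigenspace (Matrix.toLin' (M trefX)) (by omega)
    (Polynomial.X_pow_sub_C_ne_zero two_pos ω) (Polynomial.natDegree_X_pow_sub_C).le
    (aeval_toLin' _ _ (by simp [hX]))
  obtain ⟨q, hq0, hqd, hq⟩ := exists_aeval_eq_zero_of_pow_three_eq (M trefY) hY
    (by simpa [hM] using hne)
  obtain ⟨b, hb⟩ := exists_two_le_finrank_eigenspace (Matrix.toLin' (M trefY)) (by omega)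
    hq0 hqd (aeval_toLin' _ _ hq)
  have hinf : Module.End.eigenspace (Matrix.toLin' (M trefX)) a ⊓
      Module.End.eigenspace (Matrix.toLin' (M trefY)) b ≠ ⊥ := fun h => by
    have := Submodule.finrank_add_finrank_le_of_disjoint (disjoint_iff.mpr h)
    omega
  obtain ⟨v, ⟨hva, hvb⟩, hv0⟩ := Submodule.exists_mem_ne_zero_of_ne_bot hinf
  have hstab : eigenvectorStabilizer ρ v hv0 = ⊤ := TrefoilGroup.eq_top_of_mem
    ⟨a, by simpa using Module.End.mem_eigenspace_iff.mp hva⟩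
    ⟨b, by simpa using Module.End.mem_eigenspace_iff.mp hvb⟩
  have hline : ∀ γ, ∀ w ∈ ℂ ∙ v, (M γ).mulVec w ∈ ℂ ∙ v := by
    intro γ w hw
    obtain ⟨d, rfl⟩ := Submodule.mem_span_singleton.mp hw
    obtain ⟨c, hc⟩ : γ ∈ eigenvectorStabilizer ρ v hv0 := hstab ▸ Subgroup.mem_top γ
    rw [Matrix.mulVec_smul, hc]
    exact Submodule.smul_mem _ _ (Submodule.smul_mem _ _ (Submodule.mem_span_singleton_self v))
  rcases hirr _ hline with h | h
  · exact hv0 (Submodule.span_singleton_eq_bot.mp h)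
  · have h1 := finrank_span_singleton (K := ℂ) hv0
    rw [h, finrank_top] at h1
    omega
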